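/- For every r ≥ R₁ one has (φ(R₀)/2)·(a − m r) ≤ −(Φ(R₁) + f(r))·(2∫₀^{R₁} Φ(s)/φ(s) ds)^{−1}. In particular, since f is affine on [R₁, ∞) with slope φ(R₀)/2, for all r ≥ R₁ one has f'(r)(a − m r) ≤ −(ε + c·f(r)), where c = min{1/β, 1/2}·(∫₀^{R₁} Φ(s)/φ(s) ds)^{−1} and ε = min{Φ(R₁)·(2∫₀^{R₁} Φ(s)/φ(s) ds)^{−1}, (β∫₀^{R₁} φ(s)^{−1} ds)^{−1}}. -/

import Mathlib

open MeasureTheory intervalIntegral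

/-- The Eberle weight `φ(r) = exp(−(β/4)∫₀^r max{0, a − m s} ds)`. -/
noncomputable def eberlePhi (β a m r : ℝ) : ℝ :=
  Real.exp (-(β / 4) * ∫ s in (0:ℝ)..r, max 0 (a - m * s))

/-- `Φ(r) = ∫₀^r φ(s) ds`. -/
noncomputable def eberleCapPhi (β a m r : ℝ) : ℝ :=
  ∫ s in (0:ℝ)..r, eberlePhi β a m s

/-- `R₀ = a/m`. -/
noncomputable def eberleR0 (a m : ℝ) : ℝ := a / m

/-- `R₁ = a/m + 2/√m`. -/
noncomputable def eberleR1 (a m : ℝ) : ℝ := a / m + 2 / Real.sqrt m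

/-- `∫₀^{R₁} Φ(s)/φ(s) ds`. -/
noncomputable def eberleIntRatio (β a m : ℝ) : ℝ :=
  ∫ s in (0:ℝ)..(eberleR1 a m), eberleCapPhi β a m s / eberlePhi β a m s

/-- `∫₀^{R₁} φ(s)⁻¹ ds`. -/
noncomputable def eberleIntInv (β a m : ℝ) : ℝ :=
  ∫ s in (0:ℝ)..(eberleR1 a m), (eberlePhi β a m s)⁻¹

/-- The Eberle modulation function `g`. -/
noncomputable def eberleG (β a m r : ℝ) : ℝ :=
  1 - (1 / 4) * (∫ s in (0:ℝ)..(min r (eberleR1 a m)),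
        eberleCapPhi β a m s / eberlePhi β a m s) / eberleIntRatio β a m
    - (1 / 4) * (∫ s in (0:ℝ)..(min r (eberleR1 a m)),
        (eberlePhi β a m s)⁻¹) / eberleIntInv β a m

/-- The Eberle concave distance function `f(r) = ∫₀^r φ(s) g(s) ds`. -/
noncomputable def eberleF (β a m r : ℝ) : ℝ :=
  ∫ s in (0:ℝ)..r, eberlePhi β a m s * eberleG β a m s

/-- The contraction rate `c = min{1/β, 1/2} (∫₀^{R₁} Φ/φ)⁻¹`. -/
noncomputable def eberleC (β a m : ℝ) : ℝ :=
  min (1 / β) (1 / 2) * (eberleIntRatio β a m)⁻¹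

/-- The drift lower bound `ε = min{Φ(R₁)(2∫₀^{R₁} Φ/φ)⁻¹, (β∫₀^{R₁} φ⁻¹)⁻¹}`. -/
noncomputable def eberleEps (β a m : ℝ) : ℝ :=
  min (eberleCapPhi β a m (eberleR1 a m) * (2 * eberleIntRatio β a m)⁻¹)
    ((β * eberleIntInv β a m)⁻¹)

theorem eberlePhi_pos (β a m r : ℝ) : 0 < eberlePhi β a m r := Real.exp_pos _

theorem continuous_eberlePhi (β a m : ℝ) : Continuous (eberlePhi β a m) := by
  have h : Continuous fun r : ℝ => ∫ s in (0:ℝ)..r, max 0 (a - m * s) :=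
    continuous_primitive
      (fun _ _ => Continuous.intervalIntegrable (by fun_prop) _ _) 0
  unfold eberlePhi
  fun_prop

theorem continuous_eberleCapPhi (β a m : ℝ) : Continuous (eberleCapPhi β a m) :=
  continuous_primitive (fun _ _ => (continuous_eberlePhi β a m).intervalIntegrable _ _) 0

theorem continuous_eberleCapPhi_div_eberlePhi (β a m : ℝ) :
    Continuous fun s => eberleCapPhi β a m s / eberlePhi β a m s :=
  (continuous_eberleCapPhi β a m).div (continuous_eberlePhi β a m)
    fun s => (eberlePhi_pos β a m s).ne'

theorem continuous_inv_eberlePhi (β a m : ℝ) : Continuous fun s => (eberlePhi β a m s)⁻¹ :=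
  (continuous_eberlePhi β a m).inv₀ fun s => (eberlePhi_pos β a m s).ne'

theorem continuous_eberleG (β a m : ℝ) : Continuous (eberleG β a m) := by
  have h₁ := continuous_primitive (μ := volume)
    (fun x y => (continuous_eberleCapPhi_div_eberlePhi β a m).intervalIntegrable x y) 0
  have h₂ := continuous_primitive (μ := volume)
    (fun x y => (continuous_inv_eberlePhi β a m).intervalIntegrable x y) 0
  have hmin : Continuous fun r => min r (eberleR1 a m) := by fun_prop
  exact (continuous_const.sub ((continuous_const.mul (h₁.comp hmin)).div_const _)).sub
    ((continuous_const.mul (h₂.comp hmin)).div_const _)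

theorem eberleCapPhi_nonneg {r : ℝ} (β a m : ℝ) (hr : 0 ≤ r) : 0 ≤ eberleCapPhi β a m r :=
  integral_nonneg hr fun s _ => (eberlePhi_pos β a m s).le

/-- The weight `φ` is constant beyond `R₀`. -/
theorem eberlePhi_eq_of_le {m r : ℝ} (β a : ℝ) (hm : 0 < m) (hr : eberleR0 a m ≤ r) :
    eberlePhi β a m r = eberlePhi β a m (eberleR0 a m) := by
  have hint (x y : ℝ) : IntervalIntegrable (fun s => max 0 (a - m * s)) volume x y :=
    Continuous.intervalIntegrable (by fun_prop) _ _
  have hzero : ∫ s in (eberleR0 a m)..r, max 0 (a - m * s) = 0 := by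
    rw [integral_congr (g := fun _ => (0 : ℝ)), intervalIntegral.integral_zero]
    intro s hs
    rw [Set.uIcc_of_le hr] at hs
    have hs' : a ≤ s * m := (div_le_iff₀ hm).1 hs.1
    exact max_eq_left (by linarith)
  rw [eberlePhi, eberlePhi, ← integral_add_adjacent_intervals (hint 0 (eberleR0 a m)) (hint _ r),
    hzero, add_zero]

theorem eberleCapPhi_eq_of_le {m r : ℝ} (β a : ℝ) (hm : 0 < m) (hr : eberleR0 a m ≤ r) :
    eberleCapPhi β a m r = eberleCapPhi β a m (eberleR0 a m) +
      eberlePhi β a m (eberleR0 a m) * (r - eberleR0 a m) := by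
  have hint (x y : ℝ) := (continuous_eberlePhi β a m).intervalIntegrable (μ := volume) x y
  have htail : ∫ s in (eberleR0 a m)..r, eberlePhi β a m s =
      eberlePhi β a m (eberleR0 a m) * (r - eberleR0 a m) := by
    rw [integral_congr (g := fun _ => eberlePhi β a m (eberleR0 a m)),
      intervalIntegral.integral_const, smul_eq_mul, mul_comm]
    intro s hs
    rw [Set.uIcc_of_le hr] at hs
    exact eberlePhi_eq_of_le β a hm hs.1
  rw [eberleCapPhi, eberleCapPhi,
    ← integral_add_adjacent_intervals (hint 0 (eberleR0 a m)) (hint _ r), htail]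

theorem eberleR0_nonneg {a m : ℝ} (hm : 0 < m) (ha : 0 ≤ a) : 0 ≤ eberleR0 a m :=
  div_nonneg ha hm.le

theorem eberleR0_lt_eberleR1 {m : ℝ} (a : ℝ) (hm : 0 < m) : eberleR0 a m < eberleR1 a m :=
  lt_add_of_pos_right _ (div_pos two_pos (Real.sqrt_pos.2 hm))

theorem eberleR1_pos {a m : ℝ} (hm : 0 < m) (ha : 0 ≤ a) : 0 < eberleR1 a m :=
  (eberleR0_nonneg hm ha).trans_lt (eberleR0_lt_eberleR1 a hm)

theorem integral_eberleCapPhi_div_eberlePhi_mono {x y : ℝ} (β a m : ℝ) (hx : 0 ≤ x)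
    (hxy : x ≤ y) :
    ∫ s in (0:ℝ)..x, eberleCapPhi β a m s / eberlePhi β a m s ≤
      ∫ s in (0:ℝ)..y, eberleCapPhi β a m s / eberlePhi β a m s := by
  have hint (u v : ℝ) :=
    (continuous_eberleCapPhi_div_eberlePhi β a m).intervalIntegrable (μ := volume) u v
  rw [← integral_add_adjacent_intervals (hint 0 x) (hint x y)]
  exact le_add_of_nonneg_right (integral_nonneg hxy fun s hs =>
    div_nonneg (eberleCapPhi_nonneg β a m (hx.trans hs.1)) (eberlePhi_pos β a m s).le)

theorem integral_inv_eberlePhi_mono {x y : ℝ} (β a m : ℝ) (hxy : x ≤ y) :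
    ∫ s in (0:ℝ)..x, (eberlePhi β a m s)⁻¹ ≤ ∫ s in (0:ℝ)..y, (eberlePhi β a m s)⁻¹ := by
  have hint (u v : ℝ) := (continuous_inv_eberlePhi β a m).intervalIntegrable (μ := volume) u v
  rw [← integral_add_adjacent_intervals (hint 0 x) (hint x y)]
  exact le_add_of_nonneg_right (integral_nonneg hxy fun s _ =>
    (inv_pos.2 (eberlePhi_pos β a m s)).le)

/-- The contribution of `[R₀, R₁]`, where `φ` is constant, to `∫₀^{R₁} Φ/φ`. -/
theorem le_eberlePhi_mul_eberleIntRatio {a m : ℝ} (β : ℝ) (hm : 0 < m) (ha : 0 ≤ a) :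
    eberleCapPhi β a m (eberleR0 a m) * (2 / Real.sqrt m) +
        eberlePhi β a m (eberleR0 a m) * (2 / m) ≤
      eberlePhi β a m (eberleR0 a m) * eberleIntRatio β a m := by
  have hint (u v : ℝ) :=
    (continuous_eberleCapPhi_div_eberlePhi β a m).intervalIntegrable (μ := volume) u v
  have hR := (eberleR0_lt_eberleR1 a hm).le
  have hp := eberlePhi_pos β a m (eberleR0 a m)
  have hhead : 0 ≤ ∫ s in (0:ℝ)..(eberleR0 a m), eberleCapPhi β a m s / eberlePhi β a m s :=
    integral_nonneg (eberleR0_nonneg hm ha) fun s hs =>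
      div_nonneg (eberleCapPhi_nonneg β a m hs.1) (eberlePhi_pos β a m s).le
  have htail : ∫ s in (eberleR0 a m)..(eberleR1 a m),
      eberleCapPhi β a m s / eberlePhi β a m s =
      eberleCapPhi β a m (eberleR0 a m) / eberlePhi β a m (eberleR0 a m) * (2 / Real.sqrt m) +
        (2 / Real.sqrt m) ^ 2 / 2 := by
    rw [integral_eq_sub_of_hasDerivAt (f := fun s =>
      eberleCapPhi β a m (eberleR0 a m) / eberlePhi β a m (eberleR0 a m) * s +
        (s - eberleR0 a m) ^ 2 / 2) _ (hint _ _)]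
    · simp only [eberleR1, eberleR0]
      ring
    · intro s hs
      rw [Set.uIcc_of_le hR] at hs
      rw [eberleCapPhi_eq_of_le β a hm hs.1, eberlePhi_eq_of_le β a hm hs.1]
      refine (((hasDerivAt_id s).const_mul _).add
        ((((hasDerivAt_id s).sub_const (eberleR0 a m)).pow 2).div_const 2)).congr_deriv ?_
      simp only [id]
      field_simp
      push_cast
      ring
  have hsq : (2 / Real.sqrt m) ^ 2 / 2 = 2 / m := by
    rw [div_pow, Real.sq_sqrt hm.le]
    ring
  rw [eberleIntRatio, ← integral_add_adjacent_intervals (hint 0 (eberleR0 a m)) (hint _ _), htail,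
    hsq, mul_add, mul_add, ← mul_assoc, mul_div_cancel₀ _ hp.ne']
  exact le_add_of_nonneg_left (mul_nonneg hp.le hhead)

theorem eberleIntRatio_pos {a m : ℝ} (β : ℝ) (hm : 0 < m) (ha : 0 ≤ a) :
    0 < eberleIntRatio β a m := by
  have hp := eberlePhi_pos β a m (eberleR0 a m)
  have hΦ := eberleCapPhi_nonneg β a m (eberleR0_nonneg hm ha)
  refine pos_of_mul_pos_right (lt_of_lt_of_le ?_ (le_eberlePhi_mul_eberleIntRatio β hm ha)) hp.le
  positivity

theorem eberleIntInv_pos {a m : ℝ} (β : ℝ) (hm : 0 < m) (ha : 0 ≤ a) : 0 < eberleIntInv β a m :=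
  intervalIntegral_pos_of_pos ((continuous_inv_eberlePhi β a m).intervalIntegrable _ _)
    (fun s => inv_pos.2 (eberlePhi_pos β a m s)) (eberleR1_pos hm ha)

theorem eberleG_eq_half {a m r : ℝ} (β : ℝ) (hm : 0 < m) (ha : 0 ≤ a) (hr : eberleR1 a m ≤ r) :
    eberleG β a m r = 1 / 2 := by
  have hI := (eberleIntRatio_pos β hm ha).ne'
  have hJ := (eberleIntInv_pos β hm ha).ne'
  rw [eberleG, min_eq_right hr, ← eberleIntRatio, ← eberleIntInv, mul_div_cancel_right₀ _ hI,
    mul_div_cancel_right₀ _ hJ]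
  norm_num

theorem eberleG_mem_Icc {a m r : ℝ} (β : ℝ) (hm : 0 < m) (ha : 0 ≤ a) (hr : 0 ≤ r) :
    eberleG β a m r ∈ Set.Icc (1 / 2) 1 := by
  have hI := eberleIntRatio_pos β hm ha
  have hJ := eberleIntInv_pos β hm ha
  have hmin : 0 ≤ min r (eberleR1 a m) := le_min hr (eberleR1_pos hm ha).le
  have hI₀ := integral_eberleCapPhi_div_eberlePhi_mono β a m le_rfl hmin
  have hI₁ := integral_eberleCapPhi_div_eberlePhi_mono β a m hmin (min_le_right _ _)
  have hJ₀ := integral_inv_eberlePhi_mono β a m hmin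
  have hJ₁ := integral_inv_eberlePhi_mono β a m (min_le_right r (eberleR1 a m))
  rw [integral_same] at hI₀ hJ₀
  rw [← eberleIntRatio, ← div_le_one hI] at hI₁
  rw [← eberleIntInv, ← div_le_one hJ] at hJ₁
  have hI₂ := div_nonneg hI₀ hI.le
  have hJ₂ := div_nonneg hJ₀ hJ.le
  rw [eberleG, mul_div_assoc, mul_div_assoc]
  constructor <;> linarith

theorem hasDerivAt_eberleF (β a m r : ℝ) :
    HasDerivAt (eberleF β a m) (eberlePhi β a m r * eberleG β a m r) r :=
  ((continuous_eberlePhi β a m).mul (continuous_eberleG β a m)).integral_hasStrictDerivAt 0 r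
    |>.hasDerivAt

theorem eberleF_nonneg {a m r : ℝ} (β : ℝ) (hm : 0 < m) (ha : 0 ≤ a) (hr : 0 ≤ r) :
    0 ≤ eberleF β a m r :=
  integral_nonneg hr fun s hs => mul_nonneg (eberlePhi_pos β a m s).le
    (one_half_pos.le.trans (eberleG_mem_Icc β hm ha hs.1).1)

theorem eberleF_le_eberleCapPhi {a m r : ℝ} (β : ℝ) (hm : 0 < m) (ha : 0 ≤ a) (hr : 0 ≤ r) :
    eberleF β a m r ≤ eberleCapPhi β a m r :=
  integral_mono_on hr
    (((continuous_eberlePhi β a m).mul (continuous_eberleG β a m)).intervalIntegrable _ _)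
    ((continuous_eberlePhi β a m).intervalIntegrable _ _)
    fun s hs => mul_le_of_le_one_right (eberlePhi_pos β a m s).le (eberleG_mem_Icc β hm ha hs.1).2

theorem eberlePhi_mul_drift_le {a m r : ℝ} (β : ℝ) (hm : 0 < m) (ha : 0 ≤ a)
    (hr : eberleR1 a m ≤ r) :
    eberlePhi β a m (eberleR0 a m) / 2 * (a - m * r) ≤
      -(eberleCapPhi β a m (eberleR1 a m) + eberleF β a m r) * (2 * eberleIntRatio β a m)⁻¹ := by
  have hR := (eberleR0_lt_eberleR1 a hm).le
  have hI := eberleIntRatio_pos β hm ha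
  have hp := eberlePhi_pos β a m (eberleR0 a m)
  have hΦ := eberleCapPhi_nonneg β a m (eberleR0_nonneg hm ha)
  have hF := eberleF_le_eberleCapPhi β hm ha ((eberleR1_pos hm ha).le.trans hr)
  have hlow := le_eberlePhi_mul_eberleIntRatio β hm ha
  have hΦ₁ := eberleCapPhi_eq_of_le β a hm hR
  rw [eberleCapPhi_eq_of_le β a hm (hR.trans hr)] at hF
  have hsqrt := Real.sqrt_pos.2 hm
  have hmsq := Real.sq_sqrt hm.le
  obtain ⟨t, ht, rfl⟩ : ∃ t, 0 ≤ t ∧ r = eberleR1 a m + t :=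
    ⟨r - eberleR1 a m, sub_nonneg.2 hr, by ring⟩
  have hR₁ : eberleR1 a m = eberleR0 a m + 2 / Real.sqrt m := rfl
  have hdrift : m * (eberleR1 a m + t) - a = 2 * Real.sqrt m + m * t := by
    have h₁ : m * (a / m) = a := mul_div_cancel₀ a hm.ne'
    have h₂ : m * (2 / Real.sqrt m) = 2 * Real.sqrt m := by
      field_simp
      linarith
    rw [eberleR1]
    linear_combination h₁ + h₂
  have hmul := mul_le_mul_of_nonneg_right hlow
    (show 0 ≤ 2 * Real.sqrt m + m * t by positivity)
  have hexpand (u v : ℝ) : (u * (2 / Real.sqrt m) + v * (2 / m)) * (2 * Real.sqrt m + m * t) =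
      4 * u + 2 * v * (2 / Real.sqrt m) + 2 * Real.sqrt m * t * u + 2 * v * t := by
    generalize Real.sqrt m = q at *
    subst hmsq
    field_simp
    ring
  rw [hexpand] at hmul
  have hkey : eberleCapPhi β a m (eberleR1 a m) + eberleF β a m (eberleR1 a m + t) ≤
      eberlePhi β a m (eberleR0 a m) * eberleIntRatio β a m *
        (m * (eberleR1 a m + t) - a) := by
    rw [hR₁, add_sub_cancel_left] at hΦ₁
    rw [hR₁, show eberleR0 a m + 2 / Real.sqrt m + t - eberleR0 a m = 2 / Real.sqrt m + t by ring,
      ← hR₁] at hF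
    rw [hdrift, hR₁, hΦ₁, ← hR₁]
    have h₁ : 0 ≤ 2 * Real.sqrt m * t * eberleCapPhi β a m (eberleR0 a m) := by positivity
    have h₂ := mul_nonneg hp.le ht
    linarith
  rw [← div_eq_mul_inv, le_div_iff₀ (by positivity)]
  linarith

/-- Far-field drift inequality: for `r ≥ R₁`,
`(φ(R₀)/2)(a − m r) ≤ −(Φ(R₁) + f(r)) (2∫₀^{R₁}Φ/φ)⁻¹`; moreover `f` is affine on
`[R₁, ∞)` with slope `φ(R₀)/2`, so `f'(r)(a − m r) ≤ −(ε + c f(r))` for `r ≥ R₁`. -/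
theorem eberleF_far_field_drift (m β a : ℝ) (hm : 0 < m) (hβ : 0 < β) (ha : 0 ≤ a) :
    (∀ r : ℝ, eberleR1 a m ≤ r →
      eberlePhi β a m (eberleR0 a m) / 2 * (a - m * r) ≤
        -(eberleCapPhi β a m (eberleR1 a m) + eberleF β a m r) *
          (2 * eberleIntRatio β a m)⁻¹) ∧
    (∀ r : ℝ, eberleR1 a m ≤ r →
      HasDerivAt (eberleF β a m) (eberlePhi β a m (eberleR0 a m) / 2) r) ∧
    (∀ r : ℝ, eberleR1 a m ≤ r →
      eberlePhi β a m (eberleR0 a m) / 2 * (a - m * r) ≤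
        -(eberleEps β a m + eberleC β a m * eberleF β a m r)) := by
  refine ⟨fun r hr => eberlePhi_mul_drift_le β hm ha hr, fun r hr => ?_, fun r hr => ?_⟩
  · refine (hasDerivAt_eberleF β a m r).congr_deriv ?_
    rw [eberlePhi_eq_of_le β a hm ((eberleR0_lt_eberleR1 a hm).le.trans hr),
      eberleG_eq_half β hm ha hr]
    ring
  · have hF := eberleF_nonneg β hm ha ((eberleR1_pos hm ha).le.trans hr)
    have hε : eberleEps β a m ≤
        eberleCapPhi β a m (eberleR1 a m) * (2 * eberleIntRatio β a m)⁻¹ := min_le_left _ _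
    have hc : eberleC β a m ≤ (2 * eberleIntRatio β a m)⁻¹ := by
      rw [mul_inv, ← one_div (2 : ℝ)]
      exact mul_le_mul_of_nonneg_right (min_le_right _ _)
        (inv_pos.2 (eberleIntRatio_pos β hm ha)).le
    have hcF := mul_le_mul_of_nonneg_right hc hF
    have := eberlePhi_mul_drift_le β hm ha hr
    linarith
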